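/- (Convergence criteria.) Let 𝒳 and 𝒳_n (n ≥ 0) be boundedly compact pmm spaces. The following are equivalent: (i) d(𝒳_n, 𝒳) → 0; (ii) for every continuity radius r of 𝒳, dc(B̄_r(𝒳_n), B̄_r(𝒳)) → 0 as n → ∞; (iii) there exists an unbounded set I ⊆ [0,∞) such that dc(B̄_r(𝒳_n), B̄_r(𝒳)) → 0 for every r ∈ I; (iv) ∫₀^∞ e^{−r}·(1 ∧ dc(B̄_r(𝒳_n), B̄_r(𝒳))) dr → 0 as n → ∞. -/

import Mathlib

open MeasureTheory Topology Filter

noncomputable section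

/-- Prokhorov distance between finite Borel measures on a metric space. -/
def prokhorovDist {Z : Type*} [MetricSpace Z] [MeasurableSpace Z]
    (μ ν : Measure Z) : ℝ :=
  sInf {ε : ℝ | 0 < ε ∧ ∀ A : Set Z, IsClosed A →
    μ A ≤ ν (Metric.cthickening ε A) + ENNReal.ofReal ε ∧
    ν A ≤ μ (Metric.cthickening ε A) + ENNReal.ofReal ε}

/-- A pointed measured metric space: a metric space with a distinguished point and a Borel
measure. -/
structure PMM : Type 1 where
  carrier : Type
  metric : MetricSpace carrier
  basepoint : carrier
  meas : @Measure carrier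
    (@borel carrier metric.toPseudoMetricSpace.toUniformSpace.toTopologicalSpace)

attribute [instance] PMM.metric

instance PMM.instMeasurableSpace (𝒳 : PMM) : MeasurableSpace 𝒳.carrier := borel 𝒳.carrier

instance PMM.instBorelSpace (𝒳 : PMM) : BorelSpace 𝒳.carrier := ⟨rfl⟩

/-- A pmm space is boundedly compact if every closed ball is compact and has finite measure. -/
def PMM.BoundedlyCompact (𝒳 : PMM) : Prop :=
  (∀ (x : 𝒳.carrier) (r : ℝ), IsCompact (Metric.closedBall x r)) ∧
  (∀ (x : 𝒳.carrier) (r : ℝ), 𝒳.meas (Metric.closedBall x r) ≠ ⊤)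

/-- A pmm space is compact if its carrier is compact and its measure is finite. -/
def PMM.IsCompactPMM (𝒳 : PMM) : Prop :=
  CompactSpace 𝒳.carrier ∧ 𝒳.meas Set.univ ≠ ⊤

/-- A pair of maps of two pmm spaces into a common metric space. -/
structure GHPEmbedding (𝒳 𝒴 : PMM) : Type 1 where
  Z : Type
  mZ : MetricSpace Z
  f : 𝒳.carrier → Z
  g : 𝒴.carrier → Z

attribute [instance] GHPEmbedding.mZ

/-- Both maps of a `GHPEmbedding` are isometric embeddings. -/
def GHPEmbedding.IsIsometric {𝒳 𝒴 : PMM} (e : GHPEmbedding 𝒳 𝒴) : Prop :=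
  Isometry e.f ∧ Isometry e.g

/-- The quantity `max(d(f o_X, g o_Y), dH(f(X), g(Y)), dP(f_*μ_X, g_*μ_Y))` associated to a
pair of embeddings into a common space. -/
def GHPEmbedding.value {𝒳 𝒴 : PMM} (e : GHPEmbedding 𝒳 𝒴) : ℝ :=
  letI : MeasurableSpace e.Z := borel e.Z
  max (dist (e.f 𝒳.basepoint) (e.g 𝒴.basepoint))
    (max (Metric.hausdorffDist (Set.range e.f) (Set.range e.g))
      (prokhorovDist (𝒳.meas.map e.f) (𝒴.meas.map e.g)))

/-- The Gromov-Hausdorff-Prokhorov distance of compact pmm spaces. -/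
def cGHP (𝒳 𝒴 : PMM) : ℝ :=
  sInf {x : ℝ | ∃ e : GHPEmbedding 𝒳 𝒴, e.IsIsometric ∧ x = e.value}

/-- A pmm-subspace of a pmm space `𝒳`: a subset containing the basepoint together with a
measure `≤ 𝒳.meas` supported on the subset. -/
structure SubPMM (𝒳 : PMM) where
  set : Set 𝒳.carrier
  root_mem : 𝒳.basepoint ∈ set
  meas : Measure 𝒳.carrier
  meas_le : meas ≤ 𝒳.meas
  supported : meas setᶜ = 0

/-- The pmm space associated to a pmm-subspace. -/
def SubPMM.toPMM {𝒳 : PMM} (S : SubPMM 𝒳) : PMM where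
  carrier := ↥S.set
  metric := inferInstance
  basepoint := ⟨𝒳.basepoint, S.root_mem⟩
  meas := @Measure.comap ↥S.set 𝒳.carrier (borel ↥S.set) inferInstance Subtype.val S.meas

/-- The pmm-subspace ordering: inclusion of sets and inequality of measures. -/
instance {𝒳 : PMM} : LE (SubPMM 𝒳) :=
  ⟨fun S T => S.set ⊆ T.set ∧ S.meas ≤ T.meas⟩

/-- Compactness of a pmm-subspace. -/
def SubPMM.IsCompactSub {𝒳 : PMM} (S : SubPMM 𝒳) : Prop :=
  IsCompact S.set ∧ S.meas Set.univ ≠ ⊤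

/-- The closed ball of radius `r` around the basepoint, as a pmm-subspace (for `r ≥ 0` the
underlying set is exactly the closed ball; the basepoint is inserted so that the definition
makes sense for all `r`). -/
def PMM.ballSub (𝒳 : PMM) (r : ℝ) : SubPMM 𝒳 where
  set := insert 𝒳.basepoint (Metric.closedBall 𝒳.basepoint r)
  root_mem := Set.mem_insert _ _
  meas := 𝒳.meas.restrict (insert 𝒳.basepoint (Metric.closedBall 𝒳.basepoint r))
  meas_le := Measure.restrict_le_self
  supported := by
    rw [Measure.restrict_apply ((measurableSet_closedBall.insert 𝒳.basepoint).compl),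
      Set.compl_inter_self]
    simp

/-- The quantity `a(ε, r; 𝒳, 𝒴)`. -/
def aFun (ε r : ℝ) (𝒳 𝒴 : PMM) : ℝ :=
  sInf {x : ℝ | ∃ Y' : SubPMM 𝒴, Y'.IsCompactSub ∧ 𝒴.ballSub (r - ε) ≤ Y' ∧
    x = cGHP ((𝒳.ballSub r).toPMM) Y'.toPMM}

/-- The quantity `a_ε(𝒳, 𝒴) = a(ε, 1/ε; 𝒳, 𝒴)`. -/
def aEps (ε : ℝ) (𝒳 𝒴 : PMM) : ℝ := aFun ε (1 / ε) 𝒳 𝒴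

/-- The Gromov-Hausdorff-Prokhorov distance of boundedly compact pmm spaces
(with `inf ∅ = 1`). -/
def GHP (𝒳 𝒴 : PMM) : ℝ :=
  sInf (insert 1 {ε : ℝ | ε ∈ Set.Ioc (0 : ℝ) 1 ∧ max (aEps ε 𝒳 𝒴) (aEps ε 𝒴 𝒳) < ε / 2})

/-- Two pmm spaces are GHP-isometric if there is a root-preserving measure-preserving
surjective isometry between them. -/
def GHPIsometric (𝒳 𝒴 : PMM) : Prop :=
  ∃ ρ : 𝒳.carrier → 𝒴.carrier, Isometry ρ ∧ Function.Surjective ρ ∧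
    ρ 𝒳.basepoint = 𝒴.basepoint ∧ 𝒳.meas.map ρ = 𝒴.meas

/-- `r` is a continuity radius of a pmm space. -/
def PMM.ContinuityRadius (𝒳 : PMM) (r : ℝ) : Prop :=
  0 < r ∧ Metric.closedBall 𝒳.basepoint r = closure (Metric.ball 𝒳.basepoint r) ∧
    𝒳.meas (Metric.closedBall 𝒳.basepoint r \ Metric.ball 𝒳.basepoint r) = 0


/-- One-sided closeness of two pmm-subspaces mapped into a common space. -/
def HalfNear {X Y : PMM} (S : SubPMM X) (T : SubPMM Y) {Z : Type} [MetricSpace Z]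
    (f : S.set → Z) (g : T.set → Z) (δ : ℝ) : Prop :=
  (∀ x, ∃ y, dist (f x) (g y) ≤ δ) ∧
  ∀ A : Set Z, IsClosed A → S.meas (Subtype.val '' (f ⁻¹' A)) ≤
    T.meas (Subtype.val '' (g ⁻¹' (Metric.cthickening δ A))) + ENNReal.ofReal δ

/-- Two-sided closeness of two pmm-subspaces. -/
def Near {X Y : PMM} (S : SubPMM X) (T : SubPMM Y) (δ : ℝ) : Prop :=
  ∃ (Z : Type) (_ : MetricSpace Z) (f : S.set → Z) (g : T.set → Z),
    Isometry f ∧ Isometry g ∧ dist (f ⟨_, S.root_mem⟩) (g ⟨_, T.root_mem⟩) ≤ δ ∧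
    HalfNear S T f g δ ∧ HalfNear T S g f δ

lemma Near.symm {X Y : PMM} {S : SubPMM X} {T : SubPMM Y} {δ : ℝ} (h : Near S T δ) :
    Near T S δ := by
  obtain ⟨Z, i, f, g, hf, hg, h0, h1, h2⟩ := h
  exact ⟨Z, i, g, f, hg, hf, by rwa [dist_comm], h2, h1⟩

lemma toPMM_meas {X : PMM} (S : SubPMM X) (hS : IsClosed S.set) {Z : Type} [MetricSpace Z]
    (f : S.set → Z) (hf : Continuous f) (A : Set Z) (hA : IsClosed A) :
    (@Measure.map S.toPMM.carrier Z _ (borel Z) f S.toPMM.meas) A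
      = S.meas (Subtype.val '' (f ⁻¹' A)) := by
  let : MeasurableSpace Z := borel Z
  have : BorelSpace Z := ⟨rfl⟩
  have hfc : @Measurable S.toPMM.carrier Z _ _ f := by
    have : @Continuous S.toPMM.carrier Z _ _ f := hf
    exact this.measurable
  refine (Measure.map_apply (α := S.toPMM.carrier) hfc hA.measurableSet).trans ?_
  have hb : (borel ↥S.set) = Subtype.instMeasurableSpace := by
    exact (Subtype.borelSpace S.set).measurable_eq.symm
  change (@Measure.comap ↥S.set X.carrier (borel ↥S.set) inferInstance Subtype.val S.meas)
    (f ⁻¹' A) = _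
  rw [hb]
  exact (MeasurableEmbedding.subtype_coe hS.measurableSet).comap_apply _ _

lemma prokhorovDist_nonneg {Z : Type*} [MetricSpace Z] [MeasurableSpace Z]
    (μ ν : Measure Z) : 0 ≤ prokhorovDist μ ν :=
  Real.sInf_nonneg fun _ h => h.1.le

lemma value_nonneg {X Y : PMM} (e : GHPEmbedding X Y) : 0 ≤ e.value := by
  unfold GHPEmbedding.value
  exact le_max_of_le_left dist_nonneg

lemma cGHP_nonneg (X Y : PMM) : 0 ≤ cGHP X Y := by
  apply Real.sInf_nonneg
  rintro x ⟨e, -, rfl⟩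
  exact value_nonneg e

lemma cGHP_le {X Y : PMM} (e : GHPEmbedding X Y) (he : e.IsIsometric) : cGHP X Y ≤ e.value := by
  apply csInf_le
  · refine ⟨0, ?_⟩
    rintro x ⟨e, -, rfl⟩
    exact value_nonneg e
  · exact ⟨e, he, rfl⟩

lemma cGHP_le_of_near {X Y : PMM} {S : SubPMM X} {T : SubPMM Y} {δ : ℝ} (hδ : 0 < δ)
    (hS : IsClosed S.set) (hT : IsClosed T.set) (h : Near S T δ) :
    cGHP S.toPMM T.toPMM ≤ δ := by
  obtain ⟨Z, i, f, g, hf, hg, h0, h1, h2⟩ := h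
  let e : GHPEmbedding S.toPMM T.toPMM := ⟨Z, i, f, g⟩
  refine (cGHP_le e ⟨hf, hg⟩).trans ?_
  refine max_le h0 (max_le ?_ ?_)
  · apply Metric.hausdorffDist_le_of_mem_dist hδ.le
    · rintro _ ⟨x, rfl⟩
      obtain ⟨y, hy⟩ := h1.1 x
      exact ⟨_, ⟨y, rfl⟩, hy⟩
    · rintro _ ⟨x, rfl⟩
      obtain ⟨y, hy⟩ := h2.1 x
      exact ⟨_, ⟨y, rfl⟩, hy⟩
  · apply csInf_le
    · exact ⟨0, fun _ h => h.1.le⟩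
    · refine ⟨hδ, fun A hA => ?_⟩
      have hc := Metric.isClosed_cthickening (δ := δ) (E := A)
      have e1 := toPMM_meas S hS f hf.continuous
      have e2 := toPMM_meas T hT g hg.continuous
      constructor
      · have := h1.2 A hA
        rw [← e1 A hA, ← e2 _ hc] at this
        exact this
      · have := h2.2 A hA
        rw [← e2 A hA, ← e1 _ hc] at this
        exact this

lemma near_of_cGHP_lt {X Y : PMM} {S : SubPMM X} {T : SubPMM Y} {δ : ℝ}
    (hS : S.IsCompactSub) (hT : T.IsCompactSub) (h : cGHP S.toPMM T.toPMM < δ) :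
    Near S T δ := by
  have hne : {x : ℝ | ∃ e : GHPEmbedding S.toPMM T.toPMM, e.IsIsometric ∧ x = e.value}.Nonempty := by
    have : Nonempty S.toPMM.carrier := ⟨S.toPMM.basepoint⟩
    have : Nonempty T.toPMM.carrier := ⟨T.toPMM.basepoint⟩
    let e : GHPEmbedding S.toPMM T.toPMM :=
      ⟨S.toPMM.carrier ⊕ T.toPMM.carrier, Metric.metricSpaceSum, Sum.inl, Sum.inr⟩
    exact ⟨e.value, e, ⟨Metric.isometry_inl, Metric.isometry_inr⟩, rfl⟩
  obtain ⟨_, ⟨⟨Z, i, f, g⟩, ⟨hf, hg⟩, rfl⟩, he⟩ := exists_lt_of_csInf_lt hne h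
  have hf : @Isometry S.set Z _ _ f := hf
  have hg : @Isometry T.set Z _ _ g := hg
  unfold GHPEmbedding.value at he
  simp only [max_lt_iff] at he
  obtain ⟨he0, he1, he2⟩ := he
  have he0 : dist (f ⟨_, S.root_mem⟩) (g ⟨_, T.root_mem⟩) < δ := he0
  have hSc : IsCompact (Set.range f) := by
    have := isCompact_iff_compactSpace.1 hS.1
    exact isCompact_range (X := S.set) hf.continuous
  have hTc : IsCompact (Set.range g) := by
    have := isCompact_iff_compactSpace.1 hT.1
    exact isCompact_range (X := T.set) hg.continuous
  have hfin : Metric.hausdorffEDist (Set.range f) (Set.range g) ≠ ⊤ :=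
    Metric.hausdorffEDist_ne_top_of_nonempty_of_bounded ⟨_, ⟨_, S.root_mem⟩, rfl⟩
      ⟨_, ⟨_, T.root_mem⟩, rfl⟩ hSc.isBounded hTc.isBounded
  have e1 := toPMM_meas S hS.1.isClosed f hf.continuous
  have e2 := toPMM_meas T hT.1.isClosed g hg.continuous
  let : MeasurableSpace Z := borel Z
  have hne2 : {ε : ℝ | 0 < ε ∧ ∀ A : Set Z, IsClosed A →
    (Measure.map f S.toPMM.meas) A ≤ (Measure.map g T.toPMM.meas) (Metric.cthickening ε A) + ENNReal.ofReal ε ∧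
    (Measure.map g T.toPMM.meas) A ≤ (Measure.map f S.toPMM.meas) (Metric.cthickening ε A) + ENNReal.ofReal ε}.Nonempty := by
    refine ⟨(S.meas Set.univ).toReal + (T.meas Set.univ).toReal + 1, by positivity, fun A hA => ?_⟩
    rw [e1 A hA, e2 A hA]
    constructor
    · refine (measure_mono (Set.subset_univ _)).trans (le_add_left ?_)
      rw [ENNReal.le_ofReal_iff_toReal_le hS.2 (by positivity)]
      have := (T.meas Set.univ).toReal_nonneg
      linarith
    · refine (measure_mono (Set.subset_univ _)).trans (le_add_left ?_)
      rw [ENNReal.le_ofReal_iff_toReal_le hT.2 (by positivity)]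
      have := (S.meas Set.univ).toReal_nonneg
      linarith
  obtain ⟨ε, ⟨hε0, hε⟩, hεδ⟩ := exists_lt_of_csInf_lt hne2 he2
  refine ⟨Z, i, f, g, hf, hg, he0.le, ⟨fun x => ?_, fun A hA => ?_⟩, ⟨fun x => ?_, fun A hA => ?_⟩⟩
  · obtain ⟨_, ⟨y, rfl⟩, hy⟩ := Metric.exists_dist_lt_of_hausdorffDist_lt (Set.mem_range_self x) he1 hfin
    exact ⟨y, hy.le⟩
  · have := (hε A hA).1
    rw [e1 A hA, e2 _ Metric.isClosed_cthickening] at this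
    refine this.trans ?_
    gcongr
    exact Set.preimage_mono (Metric.cthickening_mono hεδ.le A)
  · obtain ⟨_, ⟨y, rfl⟩, hy⟩ := Metric.exists_dist_lt_of_hausdorffDist_lt' (Set.mem_range_self x) he1 hfin
    exact ⟨y, by rw [dist_comm]; exact hy.le⟩
  · have := (hε A hA).2
    rw [e2 A hA, e1 _ Metric.isClosed_cthickening] at this
    refine this.trans ?_
    gcongr
    exact Set.preimage_mono (Metric.cthickening_mono hεδ.le A)

lemma ballSub_set (X : PMM) {r : ℝ} (hr : 0 ≤ r) :
    (X.ballSub r).set = Metric.closedBall X.basepoint r :=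
  Set.insert_eq_of_mem (Metric.mem_closedBall_self hr)

lemma ballSub_meas (X : PMM) (r : ℝ) :
    (X.ballSub r).meas = X.meas.restrict (X.ballSub r).set := rfl

lemma ballSub_compact {X : PMM} (hX : X.BoundedlyCompact) {r : ℝ} (hr : 0 ≤ r) :
    (X.ballSub r).IsCompactSub := by
  refine ⟨?_, ?_⟩
  · rw [ballSub_set X hr]; exact hX.1 _ _
  · rw [ballSub_meas, ballSub_set X hr, Measure.restrict_apply_univ]; exact hX.2 _ _

lemma ballSub_mono (X : PMM) {r s : ℝ} (hrs : r ≤ s) : X.ballSub r ≤ X.ballSub s := by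
  have : (X.ballSub r).set ⊆ (X.ballSub s).set :=
    Set.insert_subset_insert (Metric.closedBall_subset_closedBall hrs)
  exact ⟨this, Measure.restrict_mono this le_rfl⟩

lemma halfNear_restrict {X Y : PMM} (hX : X.BoundedlyCompact) {S : SubPMM X} {T : SubPMM Y}
    {Z : Type} [MetricSpace Z] {f : S.set → Z} {g : T.set → Z} {δ η r ρ : ℝ}
    (hδ : 0 ≤ δ) (hη : 0 ≤ η) (hr : 0 ≤ r) (hρ : ρ ≤ r)
    (hf : Isometry f) (hg : Isometry g)
    (h0 : dist (f ⟨_, S.root_mem⟩) (g ⟨_, T.root_mem⟩) ≤ δ)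
    (h : HalfNear S T f g δ)
    (hSr : X.ballSub r ≤ S) (hTr : Y.ballSub r ≤ T)
    (h1 : ∀ x ∈ Metric.closedBall X.basepoint r,
      ∃ x' ∈ Metric.closedBall X.basepoint ρ, dist x x' ≤ η)
    (h2 : X.meas (Metric.closedBall X.basepoint r \ Metric.closedBall X.basepoint ρ)
      ≤ ENNReal.ofReal η)
    (h3 : ∀ y ∈ T.set, dist y Y.basepoint ≤ ρ + 2 * δ →
      ∃ y' ∈ Metric.closedBall Y.basepoint r, dist y y' ≤ η)
    (h4 : Y.meas ((T.set ∩ Metric.closedBall Y.basepoint (ρ + 2 * δ)) \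
      Metric.closedBall Y.basepoint r) ≤ ENNReal.ofReal η) :
    HalfNear (X.ballSub r) (Y.ballSub r) (f ∘ Set.inclusion hSr.1) (g ∘ Set.inclusion hTr.1)
      (δ + 2 * η) := by
  have hXs := ballSub_set X hr
  have hYs := ballSub_set Y hr
  -- points near the core
  have key : ∀ (x : S.set) (y : T.set), dist x.1 X.basepoint ≤ ρ → dist (f x) (g y) ≤ δ →
      dist y.1 Y.basepoint ≤ ρ + 2 * δ := by
    intro x y hx hxy
    have e1 : dist y.1 Y.basepoint = dist (g y) (g ⟨_, T.root_mem⟩) :=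
      (hg.dist_eq y ⟨_, T.root_mem⟩).symm
    have e2 : dist x.1 X.basepoint = dist (f x) (f ⟨_, S.root_mem⟩) :=
      (hf.dist_eq x ⟨_, S.root_mem⟩).symm
    rw [e2] at hx
    rw [e1]
    have t1 := dist_triangle4 (g y) (f x) (f ⟨_, S.root_mem⟩) (g ⟨_, T.root_mem⟩)
    rw [dist_comm (g y) (f x)] at t1
    linarith
  refine ⟨?_, ?_⟩
  · rintro ⟨x, hx⟩
    obtain ⟨x', hx', hxx'⟩ := h1 x (hXs ▸ hx)
    have hx'S : x' ∈ S.set := hSr.1 (hXs ▸ Metric.closedBall_subset_closedBall hρ hx')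
    obtain ⟨y, hy⟩ := h.1 ⟨x', hx'S⟩
    obtain ⟨y', hy', hyy'⟩ := h3 y y.2 (key ⟨x', hx'S⟩ y hx' hy)
    have hy'b : y' ∈ (Y.ballSub r).set := hYs ▸ hy'
    refine ⟨⟨y', hy'b⟩, ?_⟩
    simp only [Function.comp]
    have e1 : dist (f (Set.inclusion hSr.1 ⟨x, hx⟩)) (f ⟨x', hx'S⟩) = dist x x' := hf.dist_eq _ _
    have e2 : dist (g y) (g (Set.inclusion hTr.1 ⟨y', hy'b⟩)) = dist y.1 y' := hg.dist_eq _ _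
    have := dist_triangle4 (f (Set.inclusion hSr.1 ⟨x, hx⟩)) (f ⟨x', hx'S⟩) (g y)
      (g (Set.inclusion hTr.1 ⟨y', hy'b⟩))
    linarith
  · intro A hA
    have hρS : Metric.closedBall X.basepoint ρ ⊆ S.set := fun x hx =>
      hSr.1 (hXs ▸ Metric.closedBall_subset_closedBall hρ hx)
    set C : Set S.set := Subtype.val ⁻¹' Metric.closedBall X.basepoint ρ with hC
    have hCc : IsCompact C := by
      rw [Subtype.isCompact_iff, hC, Subtype.image_preimage_coe,
        Set.inter_eq_self_of_subset_right hρS]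
      exact hX.1 _ _
    have hA' : IsCompact (f '' C ∩ A) := (hCc.image hf.continuous).inter_right hA
    set A' := f '' C ∩ A with hA'def
    have hmain := h.2 A' hA'.isClosed
    set P := Subtype.val '' ((f ∘ Set.inclusion hSr.1) ⁻¹' A) with hP
    have hPb : P ⊆ Metric.closedBall X.basepoint r := by
      rintro _ ⟨x, -, rfl⟩
      exact hXs ▸ x.2
    have hPsub : P ∩ Metric.closedBall X.basepoint ρ ⊆ Subtype.val '' (f ⁻¹' A') := by
      rintro _ ⟨⟨x, hx, rfl⟩, hx2⟩
      exact ⟨Set.inclusion hSr.1 x, ⟨⟨_, hx2, rfl⟩, hx⟩, rfl⟩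
    set Q := Subtype.val '' ((g ∘ Set.inclusion hTr.1) ⁻¹' (Metric.cthickening (δ + 2 * η) A))
      with hQ
    have hQb : Q ⊆ (Y.ballSub r).set := by
      rintro _ ⟨x, -, rfl⟩
      exact x.2
    have hQsub : Subtype.val '' (g ⁻¹' (Metric.cthickening δ A')) ⊆
        Q ∪ ((T.set ∩ Metric.closedBall Y.basepoint (ρ + 2 * δ)) \
          Metric.closedBall Y.basepoint r) := by
      rintro _ ⟨y, hy, rfl⟩
      rw [Set.mem_preimage, hA'.cthickening_eq_biUnion_closedBall hδ] at hy
      simp only [Set.mem_iUnion, exists_prop] at hy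
      obtain ⟨_, ⟨⟨x, hx, rfl⟩, hxA⟩, hy⟩ := hy
      have hy2 : dist (f x) (g y) ≤ δ := by rw [dist_comm]; exact hy
      have hyρ := key x y hx hy2
      by_cases hyr : y.1 ∈ Metric.closedBall Y.basepoint r
      · left
        refine ⟨⟨y.1, hYs ▸ hyr⟩, ?_, rfl⟩
        refine Metric.mem_cthickening_of_dist_le _ (f x) _ _ hxA ?_
        have hy : dist (g y) (f x) ≤ δ := hy
        change dist (g y) (f x) ≤ _
        linarith
      · right
        exact ⟨⟨y.2, hyρ⟩, hyr⟩
    calc (X.ballSub r).meas P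
        ≤ (X.ballSub r).meas ((P ∩ Metric.closedBall X.basepoint ρ) ∪
          (Metric.closedBall X.basepoint r \ Metric.closedBall X.basepoint ρ)) := by
          refine measure_mono fun x hx => ?_
          by_cases hxρ : x ∈ Metric.closedBall X.basepoint ρ
          · exact Or.inl ⟨hx, hxρ⟩
          · exact Or.inr ⟨hPb hx, hxρ⟩
      _ ≤ (X.ballSub r).meas (P ∩ Metric.closedBall X.basepoint ρ) +
          (X.ballSub r).meas (Metric.closedBall X.basepoint r \ Metric.closedBall X.basepoint ρ) :=
          measure_union_le _ _
      _ ≤ S.meas (Subtype.val '' (f ⁻¹' A')) + ENNReal.ofReal η := by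
          refine add_le_add ((hSr.2 _).trans (measure_mono hPsub)) ?_
          exact ((X.ballSub r).meas_le _).trans h2
      _ ≤ (T.meas (Subtype.val '' (g ⁻¹' (Metric.cthickening δ A'))) + ENNReal.ofReal δ)
            + ENNReal.ofReal η := by gcongr
      _ ≤ (((Y.ballSub r).meas Q + ENNReal.ofReal η) + ENNReal.ofReal δ) + ENNReal.ofReal η := by
          gcongr
          refine (T.meas_le _).trans ((measure_mono hQsub).trans
            ((measure_union_le _ _).trans (add_le_add ?_ h4)))
          rw [ballSub_meas, Measure.restrict_eq_self _ hQb]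
      _ = (Y.ballSub r).meas Q + ENNReal.ofReal (δ + 2 * η) := by
          rw [two_mul, ENNReal.ofReal_add hδ (by positivity), ENNReal.ofReal_add hη hη]
          ring

/-- Continuity from above, in the form used below. -/
lemma exists_meas_le {α : Type*} [MeasurableSpace α] (μ : Measure α) (s : ℕ → Set α)
    (hs : ∀ n, MeasurableSet (s n)) (ha : Antitone s) (hfin : μ (s 0) ≠ ⊤)
    (h0 : μ (⋂ n, s n) = 0) {η : ℝ} (hη : 0 < η) : ∀ᶠ n in atTop, μ (s n) ≤ ENNReal.ofReal η := by
  have := tendsto_measure_iInter_atTop (μ := μ) (fun n => (hs n).nullMeasurableSet) ha ⟨0, hfin⟩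
  rw [h0] at this
  filter_upwards [this.eventually_lt_const (ENNReal.ofReal_pos.2 hη)] with n hn using hn.le

lemma modulus_right {X : PMM} (hX : X.BoundedlyCompact) {r η : ℝ} (hη : 0 < η) :
    ∃ t > 0, (∀ y, dist y X.basepoint ≤ r + t →
      ∃ y' ∈ Metric.closedBall X.basepoint r, dist y y' ≤ η) ∧
      X.meas (Metric.closedBall X.basepoint (r + t) \ Metric.closedBall X.basepoint r)
        ≤ ENNReal.ofReal η := by
  set u : ℕ → ℝ := fun n => 1 / ((n : ℝ) + 1) with hu
  have hu0 : ∀ n, 0 < u n := fun n => Nat.one_div_pos_of_nat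
  have hulim : Tendsto u atTop (𝓝 0) := tendsto_one_div_add_atTop_nhds_zero_nat
  have hua : Antitone u := fun a b hab => Nat.one_div_le_one_div hab
  have e1 : ∀ᶠ n in atTop, X.meas (Metric.closedBall X.basepoint (r + u n) \
      Metric.closedBall X.basepoint r) ≤ ENNReal.ofReal η := by
    apply exists_meas_le _ _ (fun n => measurableSet_closedBall.diff measurableSet_closedBall) _ _ _ hη
    · intro a b hab
      exact Set.sdiff_subset_sdiff_left (Metric.closedBall_subset_closedBall (by linarith [hua hab]))
    · exact ne_top_of_le_ne_top (hX.2 _ _) (measure_mono Set.sdiff_subset)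
    · convert measure_empty (μ := X.meas)
      rw [Set.eq_empty_iff_forall_notMem]
      intro x hx
      rw [Set.mem_iInter] at hx
      refine (hx 0).2 ?_
      have : Tendsto (fun n => r + u n) atTop (𝓝 (r + 0)) := hulim.const_add r
      rw [add_zero] at this
      exact ge_of_tendsto' this fun n => (hx n).1
  have e2 : ∃ m > r, ∀ y, dist y X.basepoint < m →
      ∃ y' ∈ Metric.closedBall X.basepoint r, dist y y' ≤ η := by
    set K := Metric.closedBall X.basepoint (r + 1) \
      Metric.thickening η (Metric.closedBall X.basepoint r) with hK
    have hKc : IsCompact K := (hX.1 _ _).diff Metric.isOpen_thickening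
    have hout : ∀ y, y ∉ K → dist y X.basepoint ≤ r + 1 →
        ∃ y' ∈ Metric.closedBall X.basepoint r, dist y y' ≤ η := by
      intro y hy hy1
      by_contra hcon
      refine hy ⟨hy1, fun ht => hcon ?_⟩
      obtain ⟨z, hz, hzy⟩ := Metric.mem_thickening_iff.1 ht
      exact ⟨z, hz, hzy.le⟩
    rcases K.eq_empty_or_nonempty with hKe | hKn
    · exact ⟨r + 1, by simp, fun y hy => hout y (by simp [hKe]) hy.le⟩
    · obtain ⟨k, hk, hmin⟩ := hKc.exists_isMinOn hKn
        (f := fun y => dist y X.basepoint) (by fun_prop)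
      have hkr : r < dist k X.basepoint := by
        by_contra hcon
        exact hk.2 (Metric.self_subset_thickening hη _ (not_lt.1 hcon))
      refine ⟨min (r + 1) (dist k X.basepoint), lt_min (by simp) hkr, fun y hy => ?_⟩
      rw [lt_min_iff] at hy
      exact hout y (fun hyK => absurd (hmin hyK) (not_le.2 hy.2)) hy.1.le
  obtain ⟨m, hm, hm'⟩ := e2
  have e3 : ∀ᶠ n in atTop, u n < m - r := hulim.eventually_lt_const (by linarith)
  obtain ⟨n, hn1, hn2⟩ := (e1.and e3).exists
  exact ⟨u n, hu0 n, fun y hy => hm' y (by linarith), hn1⟩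

lemma modulus_left {X : PMM} (hX : X.BoundedlyCompact) {r η : ℝ} (hr : X.ContinuityRadius r)
    (hη : 0 < η) :
    ∃ t > 0, (∀ y ∈ Metric.closedBall X.basepoint r,
      ∃ y' ∈ Metric.closedBall X.basepoint (r - t), dist y y' ≤ η) ∧
      X.meas (Metric.closedBall X.basepoint r \ Metric.closedBall X.basepoint (r - t))
        ≤ ENNReal.ofReal η := by
  set u : ℕ → ℝ := fun n => 1 / ((n : ℝ) + 1) with hu
  have hu0 : ∀ n, 0 < u n := fun n => Nat.one_div_pos_of_nat
  have hulim : Tendsto u atTop (𝓝 0) := tendsto_one_div_add_atTop_nhds_zero_nat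
  have hua : Antitone u := fun a b hab => Nat.one_div_le_one_div hab
  have hsub : ∀ a b, a ≤ b → Metric.closedBall X.basepoint (r - u a) ⊆
      Metric.closedBall X.basepoint (r - u b) := fun a b hab =>
    Metric.closedBall_subset_closedBall (by linarith [hua hab])
  have hmem : ∀ x, dist x X.basepoint < r → ∃ n, x ∈ Metric.closedBall X.basepoint (r - u n) := by
    intro x hx
    obtain ⟨n, hn⟩ := (hulim.eventually_lt_const (sub_pos.2 hx)).exists
    exact ⟨n, by rw [Metric.mem_closedBall]; linarith⟩
  have e1 : ∀ᶠ n in atTop, X.meas (Metric.closedBall X.basepoint r \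
      Metric.closedBall X.basepoint (r - u n)) ≤ ENNReal.ofReal η := by
    apply exists_meas_le _ _ (fun n => measurableSet_closedBall.diff measurableSet_closedBall) _ _ _ hη
    · intro a b hab
      exact Set.sdiff_subset_sdiff_right (hsub a b hab)
    · exact ne_top_of_le_ne_top (hX.2 _ _) (measure_mono Set.sdiff_subset)
    · refine measure_mono_null ?_ hr.2.2
      intro x hx
      rw [Set.mem_iInter] at hx
      refine ⟨(hx 0).1, fun hxb => ?_⟩
      obtain ⟨n, hn⟩ := hmem x hxb
      exact (hx n).2 hn
  have e2 : ∃ n, Metric.closedBall X.basepoint r ⊆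
      Metric.thickening η (Metric.closedBall X.basepoint (r - u n)) := by
    apply (hX.1 X.basepoint r).elim_directed_cover
    · exact fun n => Metric.isOpen_thickening
    · intro x hx
      rw [hr.2.1] at hx
      obtain ⟨z, hz, hxz⟩ := Metric.mem_closure_iff.1 hx η hη
      obtain ⟨n, hn⟩ := hmem z hz
      exact Set.mem_iUnion.2 ⟨n, Metric.mem_thickening_iff.2 ⟨z, hn, hxz⟩⟩
    · exact directed_of_isDirected_le fun a b hab => Metric.thickening_subset_of_subset _ (hsub a b hab)
  obtain ⟨n₀, hn₀⟩ := e2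
  obtain ⟨n, hn1, hn2⟩ := (e1.and (eventually_ge_atTop n₀)).exists
  refine ⟨u n, hu0 n, fun y hy => ?_, hn1⟩
  obtain ⟨z, hz, hyz⟩ := Metric.mem_thickening_iff.1 (hn₀ hy)
  exact ⟨z, hsub _ _ hn2 hz, hyz.le⟩


/-- Closeness of large pieces implies closeness of balls at continuity radii. -/
lemma near_ball_of_near {Y : PMM} (hY : Y.BoundedlyCompact) {r η : ℝ}
    (hr : Y.ContinuityRadius r) (hη : 0 < η) :
    ∃ δ₀ > 0, ∀ (X : PMM), X.BoundedlyCompact → ∀ (S : SubPMM X) (T : SubPMM Y) (δ : ℝ),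
      0 ≤ δ → δ ≤ δ₀ → X.ballSub r ≤ S → Y.ballSub r ≤ T → Near S T δ →
      cGHP (X.ballSub r).toPMM (Y.ballSub r).toPMM ≤ η := by
  obtain ⟨t₁, ht₁, hR, hRm⟩ := modulus_right hY (r := r) (η := η / 4) (by linarith)
  obtain ⟨t₂, ht₂, hL, hLm⟩ := modulus_left hY hr (η := η / 4) (by linarith)
  have hr0 : 0 ≤ r := hr.1.le
  refine ⟨min (η / 2) (min (t₁ / 2) (t₂ / 2)), by positivity, ?_⟩
  intro X hX S T δ hδ hδ' hS hT hST
  simp only [le_min_iff] at hδ'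
  obtain ⟨hδη, hδ1, hδ2⟩ := hδ'
  obtain ⟨Z, i, f, g, hf, hg, h0, h1, h2⟩ := hST
  apply cGHP_le_of_near hη (ballSub_compact hX hr0).1.isClosed (ballSub_compact hY hr0).1.isClosed
  have hle : δ + 2 * (η / 4) ≤ η := by linarith
  have H1 := halfNear_restrict (η := η / 4) hX hδ (by linarith) hr0 le_rfl hf hg h0 h1 hS hT
    (fun x hx => ⟨x, hx, by simp; linarith⟩) (by simp)
    (fun y _ hy => hR y (by linarith)) (le_trans (measure_mono (Set.sdiff_subset_sdiff_left
      (Set.inter_subset_right.trans (Metric.closedBall_subset_closedBall (by linarith))))) hRm)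
  have h0' := h0
  rw [dist_comm] at h0'
  have H2 := halfNear_restrict (η := η / 4) (ρ := r - 2 * δ) hY hδ (by linarith) hr0 (by linarith)
    hg hf h0' h2 hT hS
    (fun x hx => by
      obtain ⟨y, hy, hxy⟩ := hL x hx
      exact ⟨y, Metric.closedBall_subset_closedBall (by linarith) hy, hxy⟩)
    (le_trans (measure_mono (Set.sdiff_subset_sdiff_right
      (Metric.closedBall_subset_closedBall (by linarith)))) hLm)
    (fun y _ hy => ⟨y, by simpa using hy, by simp; linarith⟩)
    (by
      rw [sub_add_cancel, Set.sdiff_eq_empty.2 Set.inter_subset_right]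
      simp)
  have mono : ∀ {A B : PMM} {U : SubPMM A} {V : SubPMM B} {p : U.set → Z} {q : V.set → Z},
      HalfNear U V p q (δ + 2 * (η / 4)) → HalfNear U V p q η := by
    intro A B U V p q h
    refine ⟨fun x => ?_, fun A hA => ?_⟩
    · obtain ⟨y, hy⟩ := h.1 x
      exact ⟨y, hy.trans hle⟩
    · refine (h.2 A hA).trans ?_
      exact add_le_add (measure_mono (Set.image_mono (Set.preimage_mono
        (Metric.cthickening_mono hle A)))) (ENNReal.ofReal_le_ofReal hle)
  refine ⟨Z, i, _, _, hf.comp (fun _ _ => rfl), hg.comp (fun _ _ => rfl), ?_,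
    mono H1, mono H2⟩
  refine le_trans ?_ (show δ ≤ η by linarith)
  exact h0

/-- Right lower semicontinuity of the distance of balls. -/
lemma cGHP_ball_rlsc {X Y : PMM} (hX : X.BoundedlyCompact) (hY : Y.BoundedlyCompact) {r η : ℝ}
    (hr : 0 ≤ r) (hη : 0 < η) : ∃ t > 0, ∀ s, r ≤ s → s ≤ r + t →
      cGHP (X.ballSub r).toPMM (Y.ballSub r).toPMM ≤
        cGHP (X.ballSub s).toPMM (Y.ballSub s).toPMM + η := by
  obtain ⟨t₁, ht₁, h1, h1m⟩ := modulus_right hX (r := r) (η := η / 4) (by linarith)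
  obtain ⟨t₂, ht₂, h2, h2m⟩ := modulus_right hY (r := r) (η := η / 4) (by linarith)
  refine ⟨min t₁ t₂, by positivity, fun s hs hst => ?_⟩
  have hst1 : s ≤ r + t₁ := hst.trans (by gcongr; exact min_le_left _ _)
  have hst2 : s ≤ r + t₂ := hst.trans (by gcongr; exact min_le_right _ _)
  have hs0 : 0 ≤ s := hr.trans hs
  set c := cGHP (X.ballSub s).toPMM (Y.ballSub s).toPMM with hc
  have hc0 : 0 ≤ c := cGHP_nonneg _ _
  have hn : Near (X.ballSub s) (Y.ballSub s) (c + η / 2) :=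
    near_of_cGHP_lt (ballSub_compact hX hs0) (ballSub_compact hY hs0) (by linarith)
  obtain ⟨Z, i, f, g, hf, hg, h0, hfg, hgf⟩ := hn
  apply cGHP_le_of_near (by positivity) (ballSub_compact hX hr).1.isClosed
    (ballSub_compact hY hr).1.isClosed
  have hSX := ballSub_mono X hs
  have hSY := ballSub_mono Y hs
  have H1 := halfNear_restrict (η := η / 4) hX (by positivity) (by linarith) hr le_rfl hf hg h0 hfg
    hSX hSY (fun x hx => ⟨x, hx, by simp; linarith⟩) (by simp)
    (fun y hy _ => h2 y (by
      rw [ballSub_set Y hs0] at hy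
      exact (Metric.mem_closedBall.1 hy).trans hst2))
    (le_trans (measure_mono (Set.sdiff_subset_sdiff_left (Set.inter_subset_left.trans (by
      rw [ballSub_set Y hs0]
      exact Metric.closedBall_subset_closedBall hst2)))) h2m)
  rw [dist_comm] at h0
  have H2 := halfNear_restrict (η := η / 4) hY (by positivity) (by linarith) hr le_rfl hg hf h0 hgf
    hSY hSX (fun x hx => ⟨x, hx, by simp; linarith⟩) (by simp)
    (fun y hy _ => h1 y (by
      rw [ballSub_set X hs0] at hy
      exact (Metric.mem_closedBall.1 hy).trans hst1))
    (le_trans (measure_mono (Set.sdiff_subset_sdiff_left (Set.inter_subset_left.trans (by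
      rw [ballSub_set X hs0]
      exact Metric.closedBall_subset_closedBall hst1)))) h1m)
  have e : c + η / 2 + 2 * (η / 4) = c + η := by ring
  rw [e] at H1 H2
  refine ⟨Z, i, _, _, hf.comp (fun _ _ => rfl), hg.comp (fun _ _ => rfl), ?_,
    H1, H2⟩
  refine le_trans ?_ (show c + η / 2 ≤ c + η by linarith)
  rw [dist_comm]
  exact h0

lemma measurable_of_rlsc (G : ℝ → ℝ)
    (h : ∀ r, ∀ η > 0, ∃ t > 0, ∀ s, r ≤ s → s ≤ r + t → G r ≤ G s + η) : Measurable G := by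
  apply measurable_of_Ioi
  intro c
  set S := G ⁻¹' Set.Ioi c with hS
  have hcov : ∀ r ∈ S, ∃ t > 0, Set.Ioo r (r + t) ⊆ S := by
    intro r hr
    have hr : c < G r := hr
    obtain ⟨t, ht, h'⟩ := h r ((G r - c) / 2) (by linarith)
    refine ⟨t, ht, fun s hs => ?_⟩
    have := h' s hs.1.le hs.2.le
    change c < G s
    linarith
  have hcount : (S \ interior S).Countable := by
    refine (countable_setOfPred_isolated_right_within (s := S \ interior S)).mono ?_
    intro x hx
    refine ⟨hx, ?_⟩
    obtain ⟨t, ht, hsub⟩ := hcov x hx.1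
    rw [← Filter.empty_mem_iff_bot, mem_nhdsWithin]
    refine ⟨Set.Iio (x + t), isOpen_Iio, by simpa using ht, ?_⟩
    rintro y ⟨hy, hyD, hxy⟩
    exact hyD.2 (interior_maximal hsub isOpen_Ioo ⟨hxy, hy⟩)
  have : S = interior S ∪ (S \ interior S) := by
    rw [Set.union_sdiff_self, Set.union_eq_self_of_subset_left interior_subset]
  rw [this]
  exact isOpen_interior.measurableSet.union hcount.measurableSet

lemma measurable_cGHP_ball {X Y : PMM} (hX : X.BoundedlyCompact) (hY : Y.BoundedlyCompact) :
    Measurable (fun r : ℝ => cGHP (X.ballSub (max r 0)).toPMM (Y.ballSub (max r 0)).toPMM) := by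
  apply measurable_of_rlsc
  intro r η hη
  obtain ⟨t, ht, h⟩ := cGHP_ball_rlsc hX hY (le_max_right r 0) hη
  refine ⟨t, ht, fun s hrs hst => h _ (max_le_max_right _ hrs) ?_⟩
  refine max_le ?_ ?_
  · linarith [le_max_left r 0]
  · linarith [le_max_right r 0]

lemma countable_not_continuityRadius {X : PMM} (hX : X.BoundedlyCompact) :
    {r : ℝ | 0 < r ∧ ¬ X.ContinuityRadius r}.Countable := by
  have : ProperSpace X.carrier := ⟨hX.1⟩
  have : Nonempty X.carrier := ⟨X.basepoint⟩
  obtain ⟨D, hDc, hDd⟩ := TopologicalSpace.exists_countable_dense X.carrier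
  set m : ℝ → ENNReal := fun r => X.meas (Metric.closedBall X.basepoint r) with hm
  have hmm : Monotone m := fun a b hab => measure_mono (Metric.closedBall_subset_closedBall hab)
  set φ : X.carrier → ℝ → ℝ := fun z r => Metric.infDist z (X.ballSub r).set with hφ
  have hφm : ∀ z, Antitone (φ z) := fun z a b hab =>
    Metric.infDist_le_infDist_of_subset (ballSub_mono X hab).1 ⟨_, (X.ballSub a).root_mem⟩
  have hc : ({r | ¬ ContinuousAt m r} ∪ ⋃ z ∈ D, {r | ¬ ContinuousAt (φ z) r}).Countable :=
    hmm.countable_not_continuousAt.union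
      (hDc.biUnion fun z _ => (hφm z).countable_not_continuousAt)
  refine hc.mono ?_
  rintro r ⟨hr, hrc⟩
  by_contra hcon
  simp only [Set.mem_union, Set.mem_iUnion, Set.mem_ofPred_eq, not_or, not_not, not_exists] at hcon
  obtain ⟨hcm, hcφ⟩ := hcon
  refine hrc ⟨hr, ?_, ?_⟩
  · refine Set.Subset.antisymm ?_ Metric.closure_ball_subset_closedBall
    have hne : (Metric.ball X.basepoint r).Nonempty := ⟨_, Metric.mem_ball_self hr⟩
    have hle : ∀ z ∈ D, Metric.infDist z (Metric.ball X.basepoint r) ≤ φ z r := by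
      intro z hz
      have hcz : ContinuousAt (φ z) r := hcφ z hz
      have ht : Tendsto (φ z) (𝓝[<] r) (𝓝 (φ z r)) := hcz.tendsto.mono_left nhdsWithin_le_nhds
      refine ge_of_tendsto ht ?_
      filter_upwards [self_mem_nhdsWithin] with s hs
      refine Metric.infDist_le_infDist_of_subset ?_ ⟨_, (X.ballSub s).root_mem⟩
      exact Set.insert_subset (Metric.mem_ball_self hr) (Metric.closedBall_subset_ball hs)
    intro x hx
    rw [Metric.mem_closure_iff_infDist_zero hne]
    refine le_antisymm ?_ Metric.infDist_nonneg
    refine le_of_forall_pos_le_add fun ε hε => ?_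
    obtain ⟨z, hz, hxz⟩ := hDd.exists_dist_lt x (half_pos hε)
    have a1 : Metric.infDist x (Metric.ball X.basepoint r) ≤
      Metric.infDist z (Metric.ball X.basepoint r) + dist x z := Metric.infDist_le_infDist_add_dist
    have a2 := hle z hz
    have a3 : φ z r ≤ dist z x :=
      Metric.infDist_le_dist_of_mem (by rw [ballSub_set X hr.le]; exact hx)
    rw [dist_comm] at a3
    linarith
  · have hle : m r ≤ X.meas (Metric.ball X.basepoint r) := by
      have ht : Tendsto m (𝓝[<] r) (𝓝 (m r)) := hcm.tendsto.mono_left nhdsWithin_le_nhds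
      refine le_of_tendsto ht ?_
      filter_upwards [self_mem_nhdsWithin] with s hs
      exact measure_mono (Metric.closedBall_subset_ball hs)
    rw [measure_sdiff Metric.ball_subset_closedBall measurableSet_ball.nullMeasurableSet
      (ne_top_of_le_ne_top (hX.2 _ _) (measure_mono Metric.ball_subset_closedBall))]
    exact tsub_eq_zero_of_le hle

lemma exists_continuityRadius_gt {X : PMM} (hX : X.BoundedlyCompact) (M : ℝ) :
    ∃ r > M, X.ContinuityRadius r := by
  by_contra hcon
  push Not at hcon
  have : (Set.Ioi (max M 0)).Countable := by
    refine (countable_not_continuityRadius hX).mono fun r hr => ?_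
    exact ⟨(le_max_right _ _).trans_lt hr, hcon r ((le_max_left _ _).trans_lt hr)⟩
  have h2 := this.measure_zero volume
  simp at h2

lemma tendsto_zero_of_le {f : ℕ → ℝ} (h0 : ∀ n, 0 ≤ f n)
    (h : ∀ η > 0, ∀ᶠ n in atTop, f n ≤ η) : Tendsto f atTop (𝓝 0) := by
  refine tendsto_order.2 ⟨fun a ha => Eventually.of_forall fun n => ha.trans_le (h0 n),
    fun a ha => ?_⟩
  filter_upwards [h (a / 2) (by linarith)] with n hn
  linarith

lemma aFun_nonneg_set (ε r : ℝ) (X Y : PMM) : ∀ x ∈ {x : ℝ | ∃ Y' : SubPMM Y, Y'.IsCompactSub ∧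
    Y.ballSub (r - ε) ≤ Y' ∧ x = cGHP ((X.ballSub r).toPMM) Y'.toPMM}, 0 ≤ x := by
  rintro x ⟨Y', -, -, rfl⟩
  exact cGHP_nonneg _ _

lemma aFun_le {ε r : ℝ} (hε : 0 ≤ ε) (hr : 0 ≤ r) {X Y : PMM} (hY : Y.BoundedlyCompact) :
    aFun ε r X Y ≤ cGHP ((X.ballSub r).toPMM) ((Y.ballSub r).toPMM) :=
  csInf_le ⟨0, aFun_nonneg_set ε r X Y⟩
    ⟨Y.ballSub r, ballSub_compact hY hr, ballSub_mono Y (by linarith), rfl⟩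

lemma GHP_nonneg (X Y : PMM) : 0 ≤ GHP X Y := by
  apply Real.sInf_nonneg
  rintro x (rfl | h)
  · exact zero_le_one
  · exact h.1.1.le

lemma GHP_le {X Y : PMM} {ε : ℝ} (h0 : 0 < ε) (h1 : ε ≤ 1)
    (h : max (aEps ε X Y) (aEps ε Y X) < ε / 2) : GHP X Y ≤ ε := by
  apply csInf_le
  · refine ⟨0, ?_⟩
    rintro x (rfl | h)
    · exact zero_le_one
    · exact h.1.1.le
  · exact Or.inr ⟨⟨h0, h1⟩, h⟩

lemma cGHP_symm_le {X Y : PMM} {S : SubPMM X} {T : SubPMM Y} {δ : ℝ}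
    (hS : S.IsCompactSub) (hT : T.IsCompactSub) (h : cGHP S.toPMM T.toPMM < δ) :
    cGHP T.toPMM S.toPMM ≤ δ :=
  cGHP_le_of_near ((cGHP_nonneg _ _).trans_lt h) hT.1.isClosed hS.1.isClosed
    (near_of_cGHP_lt hS hT h).symm

lemma i_to_ii {X : PMM} {Xn : ℕ → PMM} (hX : X.BoundedlyCompact)
    (hXn : ∀ n, (Xn n).BoundedlyCompact) (h : Tendsto (fun n => GHP (Xn n) X) atTop (𝓝 0))
    {r : ℝ} (hr : X.ContinuityRadius r) :
    Tendsto (fun n => cGHP (((Xn n).ballSub r).toPMM) ((X.ballSub r).toPMM)) atTop (𝓝 0) := by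
  refine tendsto_zero_of_le (fun n => cGHP_nonneg _ _) fun η hη => ?_
  obtain ⟨δ₀, hδ₀, H⟩ := near_ball_of_near hX hr hη
  have hr0 : 0 < r := hr.1
  have hpos : 0 < min 1 (min δ₀ (1 / (r + 1))) := by positivity
  filter_upwards [h.eventually_lt_const hpos] with n hn
  obtain ⟨ε, hε, hlt⟩ := exists_lt_of_csInf_lt ⟨1, Set.mem_insert _ _⟩ hn
  simp only [lt_min_iff] at hlt
  obtain ⟨hlt1, hlt2, hlt3⟩ := hlt
  rcases hε with rfl | ⟨⟨hε0, hε1⟩, hmax⟩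
  · exact absurd hlt1 (lt_irrefl _)
  have ha := (max_lt_iff.1 hmax).1
  have hinv : r + 1 < 1 / ε := by
    rw [lt_div_iff₀ hε0]
    rw [lt_div_iff₀ (by positivity)] at hlt3
    linarith
  have hne : {x : ℝ | ∃ Y' : SubPMM X, Y'.IsCompactSub ∧ X.ballSub (1 / ε - ε) ≤ Y' ∧
      x = cGHP (((Xn n).ballSub (1 / ε)).toPMM) Y'.toPMM}.Nonempty :=
    ⟨_, X.ballSub (1 / ε), ballSub_compact hX (by positivity), ballSub_mono X (by linarith), rfl⟩
  obtain ⟨_, ⟨T, hT, hTle, rfl⟩, hclt⟩ := exists_lt_of_csInf_lt hne ha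
  have hTr : X.ballSub r ≤ T :=
    ⟨(ballSub_mono X (by linarith : r ≤ 1 / ε - ε)).1.trans hTle.1,
      (ballSub_mono X (by linarith : r ≤ 1 / ε - ε)).2.trans hTle.2⟩
  refine H (Xn n) (hXn n) ((Xn n).ballSub (1 / ε)) T (ε / 2) (by linarith) (by linarith)
    (ballSub_mono _ (by linarith)) hTr ?_
  exact near_of_cGHP_lt (ballSub_compact (hXn n) (by positivity)) hT hclt

lemma ii_to_i {X : PMM} {Xn : ℕ → PMM} (hX : X.BoundedlyCompact)
    (hXn : ∀ n, (Xn n).BoundedlyCompact) (h : ∀ r : ℝ, X.ContinuityRadius r →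
        Tendsto (fun n => cGHP (((Xn n).ballSub r).toPMM) ((X.ballSub r).toPMM))
          atTop (𝓝 0)) : Tendsto (fun n => GHP (Xn n) X) atTop (𝓝 0) := by
  refine tendsto_zero_of_le (fun n => GHP_nonneg _ _) fun η hη => ?_
  obtain ⟨R, hR, hRc⟩ := exists_continuityRadius_gt hX (max 1 (1 / η))
  rw [gt_iff_lt, max_lt_iff] at hR
  obtain ⟨hR1, hRη⟩ := hR
  have hR0 : 0 < R := hRc.1
  have hpos : 0 < 1 / R / 4 := by positivity
  filter_upwards [(h R hRc).eventually_lt_const hpos] with n hn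
  have hle : 1 / R ≤ η := by
    rw [div_lt_iff₀ hη] at hRη
    rw [div_le_iff₀ hR0]
    linarith
  refine le_trans (GHP_le (by positivity) ?_ ?_) hle
  · rw [div_le_one hR0]; exact hR1.le
  · have e : 1 / (1 / R) = R := by simp
    have hsym := cGHP_symm_le (ballSub_compact (hXn n) hR0.le) (ballSub_compact hX hR0.le) hn
    have hRR : 0 < 1 / R := by positivity
    unfold aEps
    rw [e]
    refine max_lt ?_ ?_
    · refine (aFun_le hRR.le hR0.le hX).trans_lt ?_
      linarith
    · refine (aFun_le hRR.le hR0.le (hXn n)).trans_lt ?_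
      linarith

/-- Common argument for the implications (iii) to (ii) and (iv) to (ii). -/
lemma tendsto_of_large {X : PMM} {Xn : ℕ → PMM} (hX : X.BoundedlyCompact)
    (hXn : ∀ n, (Xn n).BoundedlyCompact)
    (h : ∀ R : ℝ, 0 < R → ∀ δ > 0, ∀ᶠ n in atTop, ∃ s ≥ R,
      cGHP (((Xn n).ballSub s).toPMM) ((X.ballSub s).toPMM) < δ)
    {r : ℝ} (hr : X.ContinuityRadius r) :
    Tendsto (fun n => cGHP (((Xn n).ballSub r).toPMM) ((X.ballSub r).toPMM)) atTop (𝓝 0) := by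
  refine tendsto_zero_of_le (fun n => cGHP_nonneg _ _) fun η hη => ?_
  obtain ⟨δ₀, hδ₀, H⟩ := near_ball_of_near hX hr hη
  filter_upwards [h r hr.1 δ₀ hδ₀] with n ⟨s, hs, hlt⟩
  have hs0 : 0 ≤ s := hr.1.le.trans hs
  exact H (Xn n) (hXn n) _ _ δ₀ hδ₀.le le_rfl (ballSub_mono _ hs) (ballSub_mono _ hs)
    (near_of_cGHP_lt (ballSub_compact (hXn n) hs0) (ballSub_compact hX hs0) hlt)

lemma integrand_meas {X Y : PMM} (hX : X.BoundedlyCompact) (hY : Y.BoundedlyCompact) :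
    AEStronglyMeasurable (fun r : ℝ => Real.exp (-r) *
      min 1 (cGHP ((X.ballSub r).toPMM) ((Y.ballSub r).toPMM)))
      (volume.restrict (Set.Ioi (0 : ℝ))) := by
  have h1 : Measurable (fun r : ℝ => Real.exp (-r) *
      min 1 (cGHP (X.ballSub (max r 0)).toPMM (Y.ballSub (max r 0)).toPMM)) :=
    (Real.measurable_exp.comp measurable_neg).mul
      (measurable_const.min (measurable_cGHP_ball hX hY))
  refine h1.aestronglyMeasurable.congr ?_
  filter_upwards [ae_restrict_mem measurableSet_Ioi] with r hr
  have hr : 0 < r := hr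
  rw [max_eq_left hr.le]

lemma integrand_bound (r : ℝ) (X Y : PMM) :
    ‖Real.exp (-r) * min 1 (cGHP X Y)‖ ≤ Real.exp (-r) := by
  have h1 : 0 ≤ min 1 (cGHP X Y) := le_min zero_le_one (cGHP_nonneg _ _)
  rw [Real.norm_of_nonneg (by positivity)]
  exact mul_le_of_le_one_right (Real.exp_pos _).le (min_le_left _ _)

lemma exp_integrable : Integrable (fun r : ℝ => Real.exp (-r))
    (volume.restrict (Set.Ioi (0 : ℝ))) := by
  have := integrableOn_exp_mul_Ioi (a := -1) (by norm_num) 0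
  simpa [IntegrableOn] using this

lemma ii_to_iv {X : PMM} {Xn : ℕ → PMM} (hX : X.BoundedlyCompact)
    (hXn : ∀ n, (Xn n).BoundedlyCompact) (h : ∀ r : ℝ, X.ContinuityRadius r →
        Tendsto (fun n => cGHP (((Xn n).ballSub r).toPMM) ((X.ballSub r).toPMM))
          atTop (𝓝 0)) :
    Tendsto (fun n => ∫ r in Set.Ioi (0 : ℝ),
          Real.exp (-r) * min 1 (cGHP (((Xn n).ballSub r).toPMM) ((X.ballSub r).toPMM)))
        atTop (𝓝 0) := by
  have key := tendsto_integral_of_dominated_convergence (μ := volume.restrict (Set.Ioi (0 : ℝ)))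
    (F := fun n r => Real.exp (-r) *
      min 1 (cGHP (((Xn n).ballSub r).toPMM) ((X.ballSub r).toPMM)))
    (f := fun _ => (0 : ℝ)) (fun r => Real.exp (-r))
    (fun n => integrand_meas (hXn n) hX) exp_integrable
    (fun n => Eventually.of_forall fun r => integrand_bound r _ _) ?_
  · simpa using key
  · filter_upwards [ae_restrict_mem measurableSet_Ioi,
      ae_restrict_of_ae ((countable_not_continuityRadius hX).ae_notMem volume)] with r hr hrc
    have hcr : X.ContinuityRadius r := by
      by_contra hcon
      exact hrc ⟨hr, hcon⟩
    have := ((tendsto_const_nhds (x := (1 : ℝ))).min (h r hcr)).const_mul (Real.exp (-r))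
    simpa using this

lemma iv_large {X : PMM} {Xn : ℕ → PMM} (hX : X.BoundedlyCompact)
    (hXn : ∀ n, (Xn n).BoundedlyCompact)
    (h : Tendsto (fun n => ∫ r in Set.Ioi (0 : ℝ),
          Real.exp (-r) * min 1 (cGHP (((Xn n).ballSub r).toPMM) ((X.ballSub r).toPMM)))
        atTop (𝓝 0)) : ∀ R : ℝ, 0 < R → ∀ δ > 0, ∀ᶠ n in atTop, ∃ s ≥ R,
      cGHP (((Xn n).ballSub s).toPMM) ((X.ballSub s).toPMM) < δ := by
  intro R hR δ hδ
  set c := Real.exp (-(R + 1)) * min 1 δ with hc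
  have hc0 : 0 < c := mul_pos (Real.exp_pos _) (lt_min one_pos hδ)
  filter_upwards [h.eventually_lt_const hc0] with n hn
  by_contra hcon
  push Not at hcon
  refine absurd hn (not_lt.2 ?_)
  set F : ℝ → ℝ := fun r => Real.exp (-r) *
    min 1 (cGHP (((Xn n).ballSub r).toPMM) ((X.ballSub r).toPMM)) with hF
  have hint : IntegrableOn F (Set.Ioi 0) :=
    exp_integrable.mono' (integrand_meas (hXn n) hX)
      (Eventually.of_forall fun r => integrand_bound r _ _)
  have hsub : Set.Ioc R (R + 1) ⊆ Set.Ioi 0 := fun s hs => hR.trans hs.1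
  have hF0 : ∀ r, 0 ≤ F r := fun r =>
    mul_nonneg (Real.exp_pos _).le (le_min zero_le_one (cGHP_nonneg _ _))
  calc c = ∫ _ in Set.Ioc R (R + 1), c := by simp
    _ ≤ ∫ r in Set.Ioc R (R + 1), F r := by
        refine setIntegral_mono_on (by simp) (hint.mono_set hsub) measurableSet_Ioc ?_
        intro s hs
        refine mul_le_mul (Real.exp_le_exp.2 (by linarith [hs.2]))
          (min_le_min_left _ (hcon s hs.1.le)) (le_min zero_le_one hδ.le) (Real.exp_pos _).le
    _ ≤ ∫ r in Set.Ioi 0, F r :=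
        setIntegral_mono_set hint (Eventually.of_forall hF0) (Eventually.of_forall hsub)

/-- **Convergence criteria for the Gromov-Hausdorff-Prokhorov metric.** For boundedly
compact pmm spaces `𝒳` and `𝒳 n`, the following are equivalent:
(i) `d(𝒳 n, 𝒳) → 0`;
(ii) `dc(B̄_r(𝒳 n), B̄_r(𝒳)) → 0` for every continuity radius `r` of `𝒳`;
(iii) there is an unbounded `I ⊆ [0,∞)` with `dc(B̄_r(𝒳 n), B̄_r(𝒳)) → 0` for all `r ∈ I`;
(iv) `∫₀^∞ e^{-r} (1 ∧ dc(B̄_r(𝒳 n), B̄_r(𝒳))) dr → 0`. -/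
theorem GHP_convergence_criteria (𝒳 : PMM) (𝒳n : ℕ → PMM)
    (h𝒳 : 𝒳.BoundedlyCompact) (h𝒳n : ∀ n, (𝒳n n).BoundedlyCompact) :
    List.TFAE [
      Tendsto (fun n => GHP (𝒳n n) 𝒳) atTop (𝓝 0),
      ∀ r : ℝ, 𝒳.ContinuityRadius r →
        Tendsto (fun n => cGHP (((𝒳n n).ballSub r).toPMM) ((𝒳.ballSub r).toPMM))
          atTop (𝓝 0),
      ∃ I : Set ℝ, I ⊆ Set.Ici 0 ∧ ¬ BddAbove I ∧ ∀ r ∈ I,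
        Tendsto (fun n => cGHP (((𝒳n n).ballSub r).toPMM) ((𝒳.ballSub r).toPMM))
          atTop (𝓝 0),
      Tendsto (fun n => ∫ r in Set.Ioi (0 : ℝ),
          Real.exp (-r) * min 1 (cGHP (((𝒳n n).ballSub r).toPMM) ((𝒳.ballSub r).toPMM)))
        atTop (𝓝 0)
    ] := by
  tfae_have 1 → 2 := fun h r hr => i_to_ii h𝒳 h𝒳n h hr
  tfae_have 2 → 1 := ii_to_i h𝒳 h𝒳n
  tfae_have 2 → 4 := ii_to_iv h𝒳 h𝒳n
  tfae_have 4 → 2 := fun h r hr => tendsto_of_large h𝒳 h𝒳n (iv_large h𝒳 h𝒳n h) hr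
  tfae_have 2 → 3 := by
    intro h
    refine ⟨{r | 𝒳.ContinuityRadius r}, fun r hr => hr.1.le, ?_, fun r hr => h r hr⟩
    rintro ⟨M, hM⟩
    obtain ⟨r, hr, hrc⟩ := exists_continuityRadius_gt h𝒳 M
    exact absurd (hM hrc) (not_le.2 hr)
  tfae_have 3 → 2 := by
    rintro ⟨I, -, hI, h⟩ r hr
    refine tendsto_of_large h𝒳 h𝒳n (fun R _ δ hδ => ?_) hr
    obtain ⟨s, hs, hRs⟩ := not_bddAbove_iff.1 hI R
    filter_upwards [(h s hs).eventually_lt_const hδ] with n hn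
    exact ⟨s, hRs.le, hn⟩
  tfae_finish

end
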